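/- arXiv:2204.07448 — 3 statements merged into one kernel-verified Lean document; each statement's English description precedes it below -/
import Mathlib

section
/- Let X be a compact metric space, A a closed subalgebra of C(X) containing constants, and R the equivalence relation defined by A. Then the quotient space X/R is metrizable. -/
open scoped BigOperators

universe u

variable {X : Type u}

def sepSetoid [TopologicalSpace X] (A : Subalgebra ℝ C(X, ℝ)) : Setoid X :=
  ⟨fun a b => ∀ f ∈ A, f a = f b,
   ⟨fun _ _ _ => rfl, fun h f hf => (h f hf).symm, fun h1 h2 f hf => (h1 f hf).trans (h2 f hf)⟩⟩

def algRel [TopologicalSpace X] (A : Subalgebra ℝ C(X, ℝ)) (a b : X) : Prop :=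
  ∀ f ∈ A, f a = f b

def IsBoltFrom (R S : X → X → Prop) {n : ℕ} (x : Fin n → X) : Prop :=
  ∀ i : ℕ, ∀ h : i + 1 < n,
    x ⟨i, by omega⟩ ≠ x ⟨i + 1, h⟩ ∧
    (if i % 2 = 0 then R else S) (x ⟨i, by omega⟩) (x ⟨i + 1, h⟩)

def IsBolt (R S : X → X → Prop) {n : ℕ} (x : Fin n → X) : Prop :=
  IsBoltFrom R S x ∨ IsBoltFrom S R x

def IsClosedBolt (R S : X → X → Prop) {n : ℕ} (x : Fin n → X) : Prop :=
  ∃ hn : 0 < n, IsBolt R S (Fin.snoc x (x ⟨0, hn⟩))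

def IsInfBoltFrom (R S : X → X → Prop) (x : ℕ → X) : Prop :=
  ∀ i : ℕ, x i ≠ x (i + 1) ∧ (if i % 2 = 0 then R else S) (x i) (x (i + 1))

def IsInfBolt (R S : X → X → Prop) (x : ℕ → X) : Prop :=
  IsInfBoltFrom R S x ∨ IsInfBoltFrom S R x

def sumSet [TopologicalSpace X] (A₁ A₂ : Subalgebra ℝ C(X, ℝ)) : Set C(X, ℝ) :=
  {u | ∃ v₁ ∈ A₁, ∃ v₂ ∈ A₂, u = v₁ + v₂}

def ExtremalFin [TopologicalSpace X] [CompactSpace X] (w : C(X, ℝ)) {n : ℕ} (x : Fin n → X) : Prop :=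
  (∀ i, w (x i) = (-1 : ℝ) ^ (i : ℕ) * ‖w‖) ∨ (∀ i, w (x i) = (-1 : ℝ) ^ ((i : ℕ) + 1) * ‖w‖)

def ExtremalSeq [TopologicalSpace X] [CompactSpace X] (w : C(X, ℝ)) (x : ℕ → X) : Prop :=
  (∀ i, w (x i) = (-1 : ℝ) ^ i * ‖w‖) ∨ (∀ i, w (x i) = (-1 : ℝ) ^ (i + 1) * ‖w‖)

noncomputable def ssint {α : Type*} [MeasurableSpace α] (μ : MeasureTheory.SignedMeasure α) (g : α → ℝ) : ℝ :=
  (∫ a, g a ∂μ.toJordanDecomposition.posPart) - ∫ a, g a ∂μ.toJordanDecomposition.negPart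

def measSupport {α : Type*} [TopologicalSpace α] [MeasurableSpace α] (m : MeasureTheory.Measure α) : Set α :=
  {x | ∀ U : Set α, IsOpen U → x ∈ U → 0 < m U}

theorem stmt3 [MetricSpace X] [CompactSpace X] (A : Subalgebra ℝ C(X, ℝ))
    (hA : IsClosed (A : Set C(X, ℝ))) :
    TopologicalSpace.MetrizableSpace (Quotient (sepSetoid A)) := by
  let F (f : A) : Quotient (sepSetoid A) → ℝ :=
    Quotient.lift (fun x => (f : C(X, ℝ)) x) fun _ _ h => h f f.2
  let e (q : Quotient (sepSetoid A)) (n : ℕ) : ℝ := F (TopologicalSpace.denseSeq A n) q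
  have he : Continuous e := continuous_pi fun n =>
    Continuous.quotient_lift (TopologicalSpace.denseSeq A n : C(X, ℝ)).continuous _
  have hinj : Function.Injective e := by
    rintro ⟨x⟩ ⟨y⟩ hxy
    refine Quotient.sound fun f hf => ?_
    have hx (z : X) : Continuous fun g : A => (g : C(X, ℝ)) z :=
      (continuous_eval_const z).comp continuous_subtype_val
    exact congrFun ((TopologicalSpace.denseRange_denseSeq A).equalizer (hx x) (hx y) hxy) ⟨f, hf⟩
  exact (he.isClosedEmbedding hinj).isEmbedding.metrizableSpace
end

section
/- Let X be a compact metric space, A₁, A₂ closed subalgebras of C(X) containing constants with quotient maps s : X → X₁ and p : X → X₂ onto the respective quotient spaces. A regular Borel signed measure μ on X annihilates A₁ + A₂ (i.e., ∫_X u dμ = 0 for all u ∈ A₁+A₂) if and only if the pushforward measures s∘μ and p∘μ are identically zero, i.e., μ(s⁻¹(E₁)) = 0 and μ(p⁻¹(E₂)) = 0 for all Borel sets E₁ ⊆ X₁, E₂ ⊆ X₂. -/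
open scoped BigOperators

universe u

variable {X : Type u}

open MeasureTheory TopologicalSpace

/-- A function in `A` descends to the quotient of `X` by the relation `A` defines. -/
def liftSepSetoid [TopologicalSpace X] {A : Subalgebra ℝ C(X, ℝ)} {f : C(X, ℝ)} (hf : f ∈ A) :
    C(Quotient (sepSetoid A), ℝ) where
  toFun := Quotient.lift f fun _ _ h => h f hf
  continuous_toFun := f.continuous.quotient_lift _

lemma metrizableSpace_quotient_sepSetoid [TopologicalSpace X] [CompactSpace X]
    [MetrizableSpace X] (A : Subalgebra ℝ C(X, ℝ)) :
    MetrizableSpace (Quotient (sepSetoid A)) := by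
  let := metrizableSpaceMetric X
  let e : Quotient (sepSetoid A) → ℕ → ℝ := fun y n => liftSepSetoid (denseSeq A n).2 y
  have he : Continuous e := continuous_pi fun n => (liftSepSetoid (denseSeq A n).2).continuous
  have hinj : Function.Injective e := by
    rintro ⟨a⟩ ⟨b⟩ hab
    refine Quotient.sound fun f hf => ?_
    have hc : IsClosed {g : A | (g : C(X, ℝ)) a = (g : C(X, ℝ)) b} :=
      isClosed_eq ((continuous_eval_const a).comp continuous_subtype_val)
        ((continuous_eval_const b).comp continuous_subtype_val)
    have hsub : Set.range (denseSeq A) ⊆ {g : A | (g : C(X, ℝ)) a = (g : C(X, ℝ)) b} := by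
      rintro _ ⟨n, rfl⟩
      exact congrFun hab n
    exact hc.closure_subset_iff.2 hsub (denseRange_denseSeq A ⟨f, hf⟩)
  exact (he.isClosedEmbedding hinj).isEmbedding.metrizableSpace

/-- By Stone-Weierstrass, a closed subalgebra contains every continuous function that factors
through its quotient map. -/
lemma comp_mk_mem [TopologicalSpace X] [CompactSpace X] {A : Subalgebra ℝ C(X, ℝ)}
    (hA : IsClosed (A : Set C(X, ℝ))) (g : C(Quotient (sepSetoid A), ℝ)) :
    g.comp ⟨Quotient.mk (sepSetoid A), continuous_quotient_mk'⟩ ∈ A := by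
  let q : C(X, Quotient (sepSetoid A)) := ⟨Quotient.mk (sepSetoid A), continuous_quotient_mk'⟩
  let B := A.comap (ContinuousMap.compRightAlgHom ℝ ℝ q)
  have hB : IsClosed (B : Set C(Quotient (sepSetoid A), ℝ)) :=
    hA.preimage (ContinuousMap.compRightAlgHom_continuous ℝ ℝ q)
  have hsep : B.SeparatesPoints := by
    rintro ⟨a⟩ ⟨b⟩ hab
    by_contra! hcon
    refine hab (Quotient.sound fun f hf => ?_)
    exact hcon _ ⟨liftSepSetoid hf, (show f ∈ A from hf), rfl⟩
  have htop := ContinuousMap.subalgebra_topologicalClosure_eq_top_of_separatesPoints B hsep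
  have hg : g ∈ B.topologicalClosure := htop ▸ Algebra.mem_top
  exact hB.closure_subset hg

lemma signedMeasure_apply_eq {α : Type*} [MeasurableSpace α] (μ : SignedMeasure α)
    {E : Set α} (hE : MeasurableSet E) :
    μ E = μ.toJordanDecomposition.posPart.real E - μ.toJordanDecomposition.negPart.real E := by
  conv_lhs => rw [← μ.toSignedMeasure_toJordanDecomposition]
  exact Measure.toSignedMeasure_sub_apply hE

lemma signedMeasure_apply_eq_zero_iff {α : Type*} [MeasurableSpace α] (μ : SignedMeasure α)
    {E : Set α} (hE : MeasurableSet E) :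
    μ E = 0 ↔ μ.toJordanDecomposition.posPart E = μ.toJordanDecomposition.negPart E := by
  rw [signedMeasure_apply_eq μ hE, sub_eq_zero, measureReal_eq_measureReal_iff]

lemma ssint_add [TopologicalSpace X] [CompactSpace X] [MeasurableSpace X] [BorelSpace X]
    (μ : SignedMeasure X) (f g : C(X, ℝ)) :
    ssint μ (fun x => f x + g x) = ssint μ f + ssint μ g := by
  have hi (ν : Measure X) [IsFiniteMeasure ν] (h : C(X, ℝ)) : Integrable h ν :=
    h.continuous.integrable_of_hasCompactSupport (HasCompactSupport.of_compactSpace h)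
  simp only [ssint]
  rw [integral_add (hi _ f) (hi _ g), integral_add (hi _ f) (hi _ g)]
  ring

/-- A signed measure annihilates a closed subalgebra iff its pushforward to the quotient space
vanishes. -/
lemma ssint_eq_zero_iff_preimage_eq_zero [TopologicalSpace X] [CompactSpace X]
    [MetrizableSpace X] [MeasurableSpace X] [BorelSpace X] {A : Subalgebra ℝ C(X, ℝ)}
    (hA : IsClosed (A : Set C(X, ℝ))) (μ : SignedMeasure X) :
    (∀ f ∈ A, ssint μ f = 0) ↔
      ∀ E : Set (Quotient (sepSetoid A)), MeasurableSet[borel (Quotient (sepSetoid A))] E →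
        μ (Quotient.mk (sepSetoid A) ⁻¹' E) = 0 := by
  let : MeasurableSpace (Quotient (sepSetoid A)) := borel _
  have : BorelSpace (Quotient (sepSetoid A)) := ⟨rfl⟩
  have := metrizableSpace_quotient_sepSetoid A
  let := metrizableSpaceMetric (Quotient (sepSetoid A))
  have hq : Continuous (Quotient.mk (sepSetoid A)) := continuous_quotient_mk'
  set P := μ.toJordanDecomposition.posPart
  set N := μ.toJordanDecomposition.negPart
  have hmap (ν : Measure X) (g : C(Quotient (sepSetoid A), ℝ)) :
      ∫ y, g y ∂(ν.map (Quotient.mk (sepSetoid A))) =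
        ∫ x, g (Quotient.mk (sepSetoid A) x) ∂ν :=
    integral_map hq.aemeasurable g.continuous.aestronglyMeasurable
  have hpush : P.map (Quotient.mk (sepSetoid A)) = N.map (Quotient.mk (sepSetoid A)) ↔
      ∀ E : Set (Quotient (sepSetoid A)), MeasurableSet E →
        μ (Quotient.mk (sepSetoid A) ⁻¹' E) = 0 := by
    rw [Measure.ext_iff]
    refine forall₂_congr fun E hE => ?_
    rw [signedMeasure_apply_eq_zero_iff μ (hq.measurable hE), Measure.map_apply hq.measurable hE,
      Measure.map_apply hq.measurable hE]
  rw [← hpush]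
  constructor
  · intro h
    refine ext_of_forall_integral_eq_of_IsFiniteMeasure fun g => ?_
    have := h _ (comp_mk_mem hA g.toContinuousMap)
    exact (hmap P g.toContinuousMap).trans ((sub_eq_zero.1 this).trans
      (hmap N g.toContinuousMap).symm)
  · intro h f hf
    exact sub_eq_zero.2 ((hmap P (liftSepSetoid hf)).symm.trans
      ((congrArg (fun ν => ∫ y, liftSepSetoid hf y ∂ν) h).trans (hmap N (liftSepSetoid hf))))

theorem stmt7 [MetricSpace X] [CompactSpace X] [MeasurableSpace X] [BorelSpace X]
    (A₁ A₂ : Subalgebra ℝ C(X, ℝ))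
    (hA₁ : IsClosed (A₁ : Set C(X, ℝ))) (hA₂ : IsClosed (A₂ : Set C(X, ℝ)))
    (μ : MeasureTheory.SignedMeasure X) (hreg : μ.totalVariation.Regular) :
    (∀ v₁ ∈ A₁, ∀ v₂ ∈ A₂, ssint μ (fun x => v₁ x + v₂ x) = 0) ↔
      ((∀ E₁ : Set (Quotient (sepSetoid A₁)),
          @MeasurableSet _ (borel (Quotient (sepSetoid A₁))) E₁ →
          μ (Quotient.mk (sepSetoid A₁) ⁻¹' E₁) = 0) ∧
       (∀ E₂ : Set (Quotient (sepSetoid A₂)),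
          @MeasurableSet _ (borel (Quotient (sepSetoid A₂))) E₂ →
          μ (Quotient.mk (sepSetoid A₂) ⁻¹' E₂) = 0)) := by
  rw [← ssint_eq_zero_iff_preimage_eq_zero hA₁ μ, ← ssint_eq_zero_iff_preimage_eq_zero hA₂ μ]
  constructor
  · intro h
    refine ⟨fun f hf => ?_, fun f hf => ?_⟩
    · simpa using h f hf 0 A₂.zero_mem
    · simpa using h 0 A₁.zero_mem f hf
  · rintro ⟨h₁, h₂⟩ v₁ hv₁ v₂ hv₂
    rw [ssint_add, h₁ v₁ hv₁, h₂ v₂ hv₂, add_zero]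
end

section
/- (Singer's theorem) Let X be a compact Hausdorff space, M a linear subspace of C(X), f ∈ C(X)\M, and u₀ ∈ M. Then u₀ is a best uniform approximation to f from M if and only if there exists a regular Borel signed measure μ on X with total variation ‖μ‖ = 1, with ∫_X u dμ = 0 for all u ∈ M, and such that for the Jordan decomposition μ = μ⁺ − μ⁻, f(x) − u₀(x) = ‖f−u₀‖ for all x ∈ supp(μ⁺) and f(x) − u₀(x) = −‖f−u₀‖ for all x ∈ supp(μ⁻). -/
open scoped BigOperators

universe u

variable {X : Type u}

open MeasureTheory Set

theorem measSupport_eq_support {α : Type*} [TopologicalSpace α] [MeasurableSpace α]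
    (m : Measure α) : measSupport m = m.support := by
  rw [Measure.support_eq_forall_isOpen]
  ext x
  exact ⟨fun h U hx hU => h U hU hx, fun h U hU hx => h U hx hU⟩

/-- If the sum of two mutually singular finite measures is regular, so is the first one. -/
theorem MeasureTheory.Measure.MutuallySingular.regular_left {α : Type*} [TopologicalSpace α]
    [R1Space α] [MeasurableSpace α] [BorelSpace α] {μ ν : Measure α} [IsFiniteMeasure μ]
    [IsFiniteMeasure ν] (h : μ.MutuallySingular ν) (hr : (μ + ν).Regular) : μ.Regular := by
  have hμ : (μ + ν).restrict h.nullSetᶜ = μ := by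
    rw [Measure.restrict_add, Measure.restrict_eq_zero.2 h.measure_compl_nullSet, add_zero]
    refine Measure.restrict_eq_self_of_ae_mem ?_
    rw [ae_iff]
    simp
  rw [← hμ]
  exact Measure.Regular.restrict_of_measure_ne_top (measure_ne_top _ _)

/-- A closed condition holding on the support of a regular finite measure holds almost
everywhere. -/
theorem ae_of_forall_mem_measSupport {α : Type*} [TopologicalSpace α] [MeasurableSpace α]
    {μ : Measure α} [μ.Regular] {p : α → Prop} (h : ∀ x ∈ measSupport μ, p x) :
    ∀ᵐ x ∂μ, p x := by
  rw [measSupport_eq_support] at h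
  filter_upwards [Measure.support_mem_ae_of_innerRegularWRT_isCompact_isOpen
    (Measure.Regular.innerRegular (μ := μ))] with x hx using h x hx

theorem forall_mem_measSupport_of_ae {α : Type*} [TopologicalSpace α] [MeasurableSpace α]
    {μ : Measure α} {p : α → Prop} (hp : IsClosed {x | p x}) (h : ∀ᵐ x ∂μ, p x) :
    ∀ x ∈ measSupport μ, p x := by
  rw [measSupport_eq_support]
  exact fun x hx => Measure.support_subset_of_isClosed hp h hx

/-- A norming functional for the class of `w` modulo a subspace in which `0` is a best
approximation to `w`. -/
theorem exists_dual_annihilating {E : Type*} [SeminormedAddCommGroup E] [NormedSpace ℝ E]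
    (M : Submodule ℝ E) (w : E) (hw : ∀ u ∈ M, ‖w‖ ≤ ‖w - u‖) :
    ∃ L : E →ₗ[ℝ] ℝ, (∀ g, L g ≤ ‖g‖) ∧ (∀ u ∈ M, L u = 0) ∧ L w = ‖w‖ := by
  obtain ⟨g, hg, hgw⟩ := exists_dual_vector'' ℝ (Submodule.Quotient.mk w : E ⧸ M)
  refine ⟨g.toLinearMap ∘ₗ M.mkQ, fun x => ?_, fun u hu => ?_, ?_⟩
  · calc g (M.mkQ x) ≤ ‖g (M.mkQ x)‖ := Real.le_norm_self _
      _ ≤ 1 * ‖(Submodule.Quotient.mk x : E ⧸ M)‖ := g.le_of_opNorm_le hg _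
      _ ≤ ‖x‖ := by rw [one_mul]; exact Submodule.Quotient.norm_mk_le M x
  · simp [(Submodule.Quotient.mk_eq_zero M).2 hu]
  · have hle : ‖w‖ ≤ ‖(Submodule.Quotient.mk w : E ⧸ M)‖ := by
      refine QuotientAddGroup.le_norm_iff.2 fun m hm => ?_
      have hmem : w - m ∈ M := (Submodule.Quotient.eq M).1 (Eq.symm hm)
      simpa using hw _ hmem
    have hval : g (M.mkQ w) = ‖(Submodule.Quotient.mk w : E ⧸ M)‖ := by simpa using hgw
    exact hval.trans (le_antisymm (Submodule.Quotient.norm_mk_le M w) hle)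

/-- Riesz–Markov–Kakutani representation for positive functionals on `C(Y, ℝ)`, `Y` compact. -/
theorem exists_regular_measure_integral_eq {Y : Type*} [TopologicalSpace Y] [CompactSpace Y]
    [T2Space Y] [MeasurableSpace Y] [BorelSpace Y] (T : C(Y, ℝ) →ₗ[ℝ] ℝ)
    (hT : ∀ g, 0 ≤ g → 0 ≤ T g) :
    ∃ ρ : Measure Y, ρ.Regular ∧ IsFiniteMeasure ρ ∧ ∀ g : C(Y, ℝ), ∫ x, g x ∂ρ = T g := by
  let J : CompactlySupportedContinuousMap Y ℝ →ₗ[ℝ] C(Y, ℝ) :=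
    { toFun := fun g => g.toContinuousMap
      map_add' := fun _ _ => rfl
      map_smul' := fun _ _ => rfl }
  let Λ : CompactlySupportedContinuousMap Y ℝ →ₚ[ℝ] ℝ :=
    PositiveLinearMap.mk₀ (T ∘ₗ J) fun g hg => hT _ fun x => hg x
  have hreg : (RealRMK.rieszMeasure Λ).Regular := inferInstance
  refine ⟨RealRMK.rieszMeasure Λ, hreg, inferInstance, fun g => ?_⟩
  exact RealRMK.integral_rieszMeasure Λ (CompactlySupportedContinuousMap.continuousMapEquiv g)

/-- A functional of norm at most one which attains its norm at `w` is `‖w‖⁻¹ w` times a regular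
probability measure carried by the extremal points of `w`. -/
theorem exists_measure_of_norming {Y : Type*} [TopologicalSpace Y] [CompactSpace Y]
    [T2Space Y] [MeasurableSpace Y] [BorelSpace Y] (w : C(Y, ℝ)) (hw : 0 < ‖w‖)
    (L : C(Y, ℝ) →ₗ[ℝ] ℝ) (hL : ∀ g, L g ≤ ‖g‖) (hLw : L w = ‖w‖) :
    ∃ ρ : Measure Y, ρ.Regular ∧ IsProbabilityMeasure ρ ∧
      (∀ᵐ x ∂ρ, w x ^ 2 = ‖w‖ ^ 2) ∧ ∀ g : C(Y, ℝ), ∫ x, w x * g x ∂ρ = ‖w‖ * L g := by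
  set d := ‖w‖
  have hwx : ∀ x, |w x| ≤ d := fun x => w.norm_coe_le_norm x
  let D : C(Y, ℝ) := ContinuousMap.const Y (d ^ 2) - w * w
  have hvanish_aux : ∀ h : C(Y, ℝ), ‖h‖ ≤ 1 → L (D * h) ≤ 0 := by
    intro h hh
    have hle : ‖w + (2 * d)⁻¹ • (D * h)‖ ≤ d := by
      refine (ContinuousMap.norm_le _ hw.le).2 fun x => ?_
      have h1 : |h x| ≤ 1 := (h.norm_coe_le_norm x).trans hh
      have h2 := hwx x
      have h0 := abs_nonneg (w x)
      have hD : 0 ≤ d ^ 2 - w x * w x := by nlinarith [abs_mul_abs_self (w x)]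
      have h3 : |(d ^ 2 - w x * w x) * h x| ≤ d ^ 2 - w x * w x := by
        rw [abs_mul, abs_of_nonneg hD]
        exact mul_le_of_le_one_right hD h1
      calc |w x + (2 * d)⁻¹ * ((d ^ 2 - w x * w x) * h x)|
          ≤ |w x| + |(2 * d)⁻¹ * ((d ^ 2 - w x * w x) * h x)| := abs_add_le _ _
        _ ≤ |w x| + (2 * d)⁻¹ * (d ^ 2 - w x * w x) := by
          rw [abs_mul, abs_of_pos (by positivity : 0 < (2 * d)⁻¹)]
          gcongr
        _ ≤ d := by
          rw [← abs_mul_abs_self (w x), ← le_sub_iff_add_le', inv_mul_le_iff₀ (by positivity)]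
          nlinarith
    have := (hL _).trans hle
    rw [map_add, map_smul, hLw, smul_eq_mul] at this
    have h4 : (2 * d)⁻¹ * L (D * h) ≤ 0 := by linarith
    exact nonpos_of_mul_nonpos_right h4 (by positivity)
  have hvanish : ∀ h : C(Y, ℝ), L (D * h) = 0 := by
    have hone : ∀ h : C(Y, ℝ), ‖h‖ ≤ 1 → L (D * h) = 0 := fun h hh => by
      have h1 := hvanish_aux h hh
      have h2 := hvanish_aux (-h) (by rwa [norm_neg])
      rw [mul_neg, map_neg] at h2
      linarith
    intro h
    have h1 := hone ((‖h‖ + 1)⁻¹ • h) (by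
      rw [norm_smul, norm_inv, Real.norm_of_nonneg (by positivity),
        inv_mul_le_iff₀ (by positivity)]
      linarith)
    rw [mul_smul_comm, map_smul, smul_eq_mul] at h1
    exact (mul_eq_zero.1 h1).resolve_left (by positivity)
  have hpos : ∀ g : C(Y, ℝ), 0 ≤ g → 0 ≤ L (w * g) := by
    intro g hg
    have hle : ‖w - (‖g‖ + 1)⁻¹ • (w * g)‖ ≤ d := by
      refine (ContinuousMap.norm_le _ hw.le).2 fun x => ?_
      have hgx : 0 ≤ g x := hg x
      have h1 : (‖g‖ + 1)⁻¹ * g x ≤ 1 := by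
        rw [inv_mul_le_iff₀ (by positivity)]
        have := (le_abs_self _).trans (g.norm_coe_le_norm x)
        linarith
      have h2 : 0 ≤ (‖g‖ + 1)⁻¹ * g x := by positivity
      calc |w x - (‖g‖ + 1)⁻¹ * (w x * g x)| = |w x * (1 - (‖g‖ + 1)⁻¹ * g x)| := by ring_nf
        _ = |w x| * (1 - (‖g‖ + 1)⁻¹ * g x) := by rw [abs_mul, abs_of_nonneg (sub_nonneg.2 h1)]
        _ ≤ |w x| := mul_le_of_le_one_right (abs_nonneg _) (by linarith)
        _ ≤ d := hwx x
    have := (hL _).trans hle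
    rw [map_sub, map_smul, hLw, smul_eq_mul] at this
    have h4 : 0 ≤ (‖g‖ + 1)⁻¹ * L (w * g) := by linarith
    exact nonneg_of_mul_nonneg_right h4 (by positivity)
  obtain ⟨ρ, hreg, hfin, hρ⟩ := exists_regular_measure_integral_eq
    (d⁻¹ • (L ∘ₗ LinearMap.mulLeft ℝ w))
    fun g hg => mul_nonneg (inv_nonneg.2 hw.le) (hpos g hg)
  replace hρ : ∀ g : C(Y, ℝ), ∫ x, g x ∂ρ = d⁻¹ * L (w * g) := hρ
  refine ⟨ρ, hreg, ?_, ?_, fun g => ?_⟩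
  · have h1 := hρ 1
    rw [mul_one, hLw, inv_mul_cancel₀ hw.ne'] at h1
    simp only [ContinuousMap.one_apply, integral_const, smul_eq_mul, mul_one] at h1
    exact ⟨(ENNReal.toReal_eq_one_iff _).1 h1⟩
  · have h0 : ∫ x, D x ∂ρ = 0 := by rw [hρ, mul_comm w D, hvanish, mul_zero]
    have hnn : ∀ x, 0 ≤ D x := fun x => by
      change 0 ≤ d ^ 2 - w x * w x
      nlinarith [hwx x, abs_nonneg (w x), abs_mul_abs_self (w x)]
    have hint : Integrable D ρ :=
      D.continuous.integrable_of_hasCompactSupport (HasCompactSupport.of_compactSpace D)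
    filter_upwards [(integral_eq_zero_iff_of_nonneg hnn hint).1 h0] with x hx
    have hx' : d ^ 2 - w x * w x = 0 := hx
    linarith [sq (w x)]
  · have h1 := hρ (w * g)
    have h2 : w * (w * g) = d ^ 2 • g - D * g := by
      ext x
      simp only [D, ContinuousMap.mul_apply, ContinuousMap.sub_apply, ContinuousMap.smul_apply,
        ContinuousMap.const_apply, smul_eq_mul]
      ring
    rw [h2, map_sub, hvanish, map_smul, smul_eq_mul, sub_zero] at h1
    change ∫ x, (w * g) x ∂ρ = _
    rw [h1]
    field_simp

/-- A probability measure `ρ` carried by `{|w| = d}` gives the signed measure `d⁻¹ w ρ`, described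
by its Jordan decomposition. -/
theorem exists_signedMeasure_of_ae_sq_eq {Y : Type*} [TopologicalSpace Y] [CompactSpace Y]
    [MeasurableSpace Y] [BorelSpace Y] (w : C(Y, ℝ)) {d : ℝ} (hd : 0 < d) (ρ : Measure Y)
    [IsFiniteMeasure ρ] (hρ : ∀ᵐ x ∂ρ, w x ^ 2 = d ^ 2) :
    ∃ μ : SignedMeasure Y, μ.totalVariation = ρ ∧
      (∀ g : C(Y, ℝ), d * ssint μ g = ∫ x, w x * g x ∂ρ) ∧
      (∀ᵐ x ∂μ.toJordanDecomposition.posPart, w x = d) ∧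
      (∀ᵐ x ∂μ.toJordanDecomposition.negPart, w x = -d) := by
  set A : Set Y := {x | w x = d}
  set B : Set Y := {x | w x = -d}
  have hA : MeasurableSet A := (isClosed_eq w.continuous continuous_const).measurableSet
  have hB : MeasurableSet B := (isClosed_eq w.continuous continuous_const).measurableSet
  have hAB : Disjoint A B := Set.disjoint_left.2 fun x hx hx' => by
    have h1 : w x = d := hx
    have h2 : w x = -d := hx'
    linarith
  have hsum : ρ.restrict A + ρ.restrict B = ρ := by
    rw [← Measure.restrict_union hAB hB]
    refine Measure.restrict_eq_self_of_ae_mem ?_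
    filter_upwards [hρ] with x hx using sq_eq_sq_iff_eq_or_eq_neg.1 hx
  let j : JordanDecomposition Y :=
    { posPart := ρ.restrict A
      negPart := ρ.restrict B
      mutuallySingular := ⟨Aᶜ, hA.compl, by simp [Measure.restrict_apply hA.compl], by
        simp [Measure.restrict_apply hA, hAB.inter_eq]⟩ }
  have hj : j.toSignedMeasure.toJordanDecomposition = j :=
    j.toJordanDecomposition_toSignedMeasure
  refine ⟨j.toSignedMeasure, ?_, fun g => ?_, ?_, ?_⟩
  · rw [SignedMeasure.totalVariation, hj]
    exact hsum
  · have hint : Integrable (fun x => w x * g x) ρ :=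
      (w * g).continuous.integrable_of_hasCompactSupport (HasCompactSupport.of_compactSpace _)
    rw [ssint, hj]
    change d * (∫ x in A, g x ∂ρ - ∫ x in B, g x ∂ρ) = _
    have h1 : ∫ x in A, w x * g x ∂ρ = d * ∫ x in A, g x ∂ρ := by
      rw [← integral_const_mul]
      exact setIntegral_congr_fun hA fun x hx => congrArg (· * g x) hx
    have h2 : ∫ x in B, w x * g x ∂ρ = -d * ∫ x in B, g x ∂ρ := by
      rw [← integral_const_mul]
      exact setIntegral_congr_fun hB fun x hx => congrArg (· * g x) hx
    conv_rhs => rw [← hsum]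
    rw [integral_add_measure hint.integrableOn hint.integrableOn, h1, h2]
    ring
  · rw [hj]
    exact ae_restrict_mem hA
  · rw [hj]
    exact ae_restrict_mem hB

/-- A signed measure annihilating `u` and concentrated on the extremal points of `w`, with matching
signs, witnesses that `w - u` is no smaller than `w`. -/
theorem norm_le_of_signedMeasure {Y : Type*} [TopologicalSpace Y] [CompactSpace Y] [T2Space Y]
    [MeasurableSpace Y] [BorelSpace Y] (w u : C(Y, ℝ)) (μ : SignedMeasure Y)
    (hreg : μ.totalVariation.Regular) (hμ : μ.totalVariation univ = 1) (hu : ssint μ u = 0)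
    (hpos : ∀ x ∈ measSupport μ.toJordanDecomposition.posPart, w x = ‖w‖)
    (hneg : ∀ x ∈ measSupport μ.toJordanDecomposition.negPart, w x = -‖w‖) :
    ‖w‖ ≤ ‖w - u‖ := by
  have hs := μ.toJordanDecomposition.mutuallySingular
  rw [ssint] at hu
  rw [SignedMeasure.totalVariation] at hreg hμ
  generalize hP : μ.toJordanDecomposition.posPart = P at *
  generalize hN : μ.toJordanDecomposition.negPart = N at *
  have hPfin : IsFiniteMeasure P := hP ▸ inferInstance
  have hNfin : IsFiniteMeasure N := hN ▸ inferInstance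
  have hPreg : P.Regular := hs.regular_left hreg
  have hNreg : N.Regular := hs.symm.regular_left (add_comm P N ▸ hreg)
  have hint : ∀ (g : C(Y, ℝ)) (m : Measure Y) [IsFiniteMeasure m], Integrable g m := fun g m _ =>
    g.continuous.integrable_of_hasCompactSupport (HasCompactSupport.of_compactSpace g)
  have hmass : P.real univ + N.real univ = 1 := by
    rw [← measureReal_add_apply, measureReal_def, hμ, ENNReal.toReal_one]
  have hxu : ∀ x, |w x - u x| ≤ ‖w - u‖ := (w - u).norm_coe_le_norm
  have h1 : ∫ x, (‖w‖ - u x) ∂P ≤ ∫ _, ‖w - u‖ ∂P := by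
    refine integral_mono_ae ((integrable_const _).sub (hint u P)) (integrable_const _) ?_
    filter_upwards [ae_of_forall_mem_measSupport hpos] with x hx
    rw [← hx]
    exact (le_abs_self _).trans (hxu x)
  have h2 : ∫ x, (‖w‖ + u x) ∂N ≤ ∫ _, ‖w - u‖ ∂N := by
    refine integral_mono_ae ((integrable_const _).add (hint u N)) (integrable_const _) ?_
    filter_upwards [ae_of_forall_mem_measSupport hneg] with x hx
    linarith [(neg_le_abs _).trans (hxu x)]
  rw [integral_sub (integrable_const _) (hint u P), integral_const, integral_const, smul_eq_mul,
    smul_eq_mul] at h1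
  rw [integral_add (integrable_const _) (hint u N), integral_const, integral_const, smul_eq_mul,
    smul_eq_mul] at h2
  calc ‖w‖ = (P.real univ + N.real univ) * ‖w‖ := by rw [hmass, one_mul]
    _ ≤ (P.real univ + N.real univ) * ‖w - u‖ := by linarith
    _ = ‖w - u‖ := by rw [hmass, one_mul]

/-- Singer's theorem -/
theorem stmt14 {Y : Type*} [TopologicalSpace Y] [CompactSpace Y] [T2Space Y]
    [MeasurableSpace Y] [BorelSpace Y]
    (M : Submodule ℝ C(Y, ℝ)) (f : C(Y, ℝ)) (hf : f ∉ M)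
    (u₀ : C(Y, ℝ)) (hu₀ : u₀ ∈ M) :
    (∀ u ∈ M, ‖f - u₀‖ ≤ ‖f - u‖) ↔
      ∃ μ : MeasureTheory.SignedMeasure Y,
        μ.totalVariation.Regular ∧
        μ.totalVariation Set.univ = 1 ∧
        (∀ u ∈ M, ssint μ u = 0) ∧
        (∀ x ∈ measSupport μ.toJordanDecomposition.posPart, f x - u₀ x = ‖f - u₀‖) ∧
        (∀ x ∈ measSupport μ.toJordanDecomposition.negPart, f x - u₀ x = -‖f - u₀‖) := by
  constructor
  · intro hbest
    have hw : 0 < ‖f - u₀‖ := norm_pos_iff.2 fun h => hf (sub_eq_zero.1 h ▸ hu₀)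
    obtain ⟨L, hL, hLM, hLw⟩ := exists_dual_annihilating M (f - u₀) fun u hu => by
      simpa [sub_sub] using hbest (u₀ + u) (M.add_mem hu₀ hu)
    obtain ⟨ρ, hreg, hprob, hae, hint⟩ := exists_measure_of_norming (f - u₀) hw L hL hLw
    obtain ⟨μ, hμ, hss, hpos, hneg⟩ := exists_signedMeasure_of_ae_sq_eq (f - u₀) hw ρ hae
    refine ⟨μ, hμ ▸ hreg, by rw [hμ, measure_univ], fun u hu => ?_,
      forall_mem_measSupport_of_ae
        (isClosed_eq (f - u₀).continuous continuous_const) hpos,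
      forall_mem_measSupport_of_ae
        (isClosed_eq (f - u₀).continuous continuous_const) hneg⟩
    have h := hss u
    rw [hint, hLM u hu, mul_zero] at h
    exact (mul_eq_zero.1 h).resolve_left hw.ne'
  · rintro ⟨μ, hreg, hμ, hM, hpos, hneg⟩ u hu
    simpa using norm_le_of_signedMeasure (f - u₀) (u - u₀) μ hreg hμ
      (hM _ (M.sub_mem hu hu₀)) hpos hneg
end
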